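/- For every natural number n ≥ 2, the diagonal integrals satisfy (2n+1)·N_{n,n} = (2n−1)·N_{n−1,n−1} + ((2n−1)·(n+1)/n)·N_{n+1,n−1} − ((2n+1)·(n−1)/n)·N_{n,n−2}. -/

import Mathlib

open MeasureTheory Real

/-- The Legendre polynomials, defined by `P 0 x = 1`, `P 1 x = x` and the
three-term recurrence `(n+1) * P (n+1) x = (2*n+1) * x * P n x - n * P (n-1) x` for `n ≥ 1`. -/
noncomputable def legendreP : ℕ → ℝ → ℝ
  | 0, _ => 1
  | 1, x => x
  | (n + 2), x =>
      ((2 * (n + 1 : ℝ) + 1) * x * legendreP (n + 1) x - (n + 1 : ℝ) * legendreP n x)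
        / ((n + 1 : ℝ) + 1)

/-- `N n m = ∫₀¹ Pₙ(2x-1) Pₘ(2x-1) log x dx`. -/
noncomputable def N (n m : ℕ) : ℝ :=
  ∫ x in (0:ℝ)..1, legendreP n (2 * x - 1) * legendreP m (2 * x - 1) * Real.log x

theorem continuous_legendreP (n : ℕ) : Continuous (legendreP n) := by
  induction n using Nat.strong_induction_on with
  | _ n ih =>
    match n with
    | 0 => exact (continuous_const (y := (1 : ℝ))).congr fun x => by simp [legendreP]
    | 1 => exact continuous_id.congr fun x => by simp [legendreP]
    | k + 2 =>
      have h₀ := ih k (by omega)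
      have h₁ := ih (k + 1) (by omega)
      have h₂ : Continuous fun x : ℝ =>
          ((2 * (k + 1 : ℝ) + 1) * x * legendreP (k + 1) x - (k + 1 : ℝ) * legendreP k x)
            / ((k + 1 : ℝ) + 1) := by fun_prop
      exact h₂.congr fun x => by rw [legendreP]

theorem legendreP_recurrence (n : ℕ) (x : ℝ) :
    ((n : ℝ) + 2) * legendreP (n + 2) x =
      (2 * (n : ℝ) + 3) * x * legendreP (n + 1) x - ((n : ℝ) + 1) * legendreP n x := by
  have h : (n : ℝ) + 1 + 1 ≠ 0 := by positivity
  rw [legendreP]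
  field_simp
  ring

theorem intervalIntegrable_legendreP_mul_log (n m : ℕ) :
    IntervalIntegrable
      (fun x => legendreP n (2 * x - 1) * legendreP m (2 * x - 1) * Real.log x) volume 0 1 := by
  have hn := continuous_legendreP n
  have hm := continuous_legendreP m
  exact intervalIntegral.intervalIntegrable_log'.continuousOn_mul (by fun_prop)

theorem stmt_9 (n : ℕ) (h : 2 ≤ n) :
    (2 * (n : ℝ) + 1) * N n n =
      (2 * (n : ℝ) - 1) * N (n - 1) (n - 1)
        + (2 * (n : ℝ) - 1) * ((n : ℝ) + 1) / (n : ℝ) * N (n + 1) (n - 1)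
        - (2 * (n : ℝ) + 1) * ((n : ℝ) - 1) / (n : ℝ) * N n (n - 2) := by
  obtain ⟨k, rfl⟩ := Nat.exists_eq_add_of_le' h
  rw [show k + 2 - 1 = k + 1 by omega, show k + 2 - 2 = k by omega,
    show k + 2 + 1 = k + 3 by omega]
  have hi := intervalIntegrable_legendreP_mul_log
  unfold N
  simp only [← intervalIntegral.integral_const_mul]
  rw [← intervalIntegral.integral_add ((hi _ _).const_mul _) ((hi _ _).const_mul _),
    ← intervalIntegral.integral_sub
      (((hi _ _).const_mul _).add ((hi _ _).const_mul _)) ((hi _ _).const_mul _)]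
  congr 1
  ext x
  have h₁ := legendreP_recurrence k (2 * x - 1)
  have h₂ := legendreP_recurrence (k + 1) (2 * x - 1)
  simp only [add_assoc, Nat.reduceAdd] at h₂
  push_cast at h₂ ⊢
  have hk : (k : ℝ) + 2 ≠ 0 := by positivity
  generalize legendreP (k + 3) (2 * x - 1) = d at *
  generalize legendreP (k + 2) (2 * x - 1) = c at *
  generalize legendreP (k + 1) (2 * x - 1) = b at *
  generalize legendreP k (2 * x - 1) = a at *
  field_simp
  linear_combination (2 * (k : ℝ) + 5) * c * Real.log x * h₁
    - (2 * (k : ℝ) + 3) * b * Real.log x * h₂
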